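/- Let p be an odd prime and let a, b be p-integers with ab ≢ 0 (mod p), ⟨b⟩_p ≤ p − 1 − ⟨a⟩_p and ⟨b⟩_p > ⟨a⟩_p. Set t = (a − ⟨a⟩_p)/p and s = (b − ⟨b⟩_p)/p, and assume s ≢ −1 (mod p). Then Σ_{k=0}^{p−1} C(a,k)·C(−1−a,k)/(k + b) ≡ ((s + 1 + t)/(b(s + 1))) · ( C(⟨b⟩_p − 1, ⟨a⟩_p)/C(p − 1 − ⟨b⟩_p, ⟨a⟩_p) ) · ( 1 + p(s+1)/b + p(2s+1)·H_{⟨b⟩_p − 1} − p(s − t)·H_{⟨b⟩_p − ⟨a⟩_p − 1} − p(s + t + 1)·H_{⟨a⟩_p + ⟨b⟩_p} ) (mod p²). -/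

import Mathlib

/-- A rational number is a `p`-integer if its denominator (in lowest terms)
is not divisible by `p`. -/
def isPInt (p : ℕ) (x : ℚ) : Prop := ¬ p ∣ x.den

/-- For `p`-integers `u, v`, `u ≡ v (mod p^k)` means `(u - v)/p^k` is a `p`-integer. -/
def pCong (p k : ℕ) (u v : ℚ) : Prop := isPInt p ((u - v) / (p : ℚ) ^ k)

/-- The generalized binomial coefficient `C(a, k) = a(a-1)⋯(a-k+1)/k!`. -/
def rchoose (a : ℚ) (k : ℕ) : ℚ := (∏ i ∈ Finset.range k, (a - i)) / (k.factorial : ℚ)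

section PIntegers

variable {p : ℕ} [hp : Fact p.Prime]

lemma isPInt_int (n : ℤ) : isPInt p n := by
  simp [isPInt, hp.out.ne_one]

lemma isPInt_nat (n : ℕ) : isPInt p n := by
  simpa using isPInt_int (p := p) (n : ℤ)

lemma isPInt.add {x y : ℚ} (hx : isPInt p x) (hy : isPInt p y) : isPInt p (x + y) := fun h =>
  (hp.out.dvd_mul.1 (h.trans (Rat.add_den_dvd x y))).elim hx hy

lemma isPInt.mul {x y : ℚ} (hx : isPInt p x) (hy : isPInt p y) : isPInt p (x * y) := fun h =>
  (hp.out.dvd_mul.1 (h.trans (Rat.mul_den_dvd x y))).elim hx hy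

variable (p) in
/-- The ring of `p`-integers. -/
def pIntegers : Subring ℚ where
  carrier := {x | isPInt p x}
  mul_mem' := isPInt.mul
  add_mem' := isPInt.add
  one_mem' := by simpa using isPInt_int (p := p) 1
  zero_mem' := by simpa using isPInt_int (p := p) 0
  neg_mem' := by intro x hx; simpa [isPInt] using hx

lemma mem_pIntegers {x : ℚ} : x ∈ pIntegers p ↔ isPInt p x := Iff.rfl

lemma natCast_prime_ne_zero : (p : ℚ) ≠ 0 := by exact_mod_cast hp.out.ne_zero

lemma inv_natCast_mem {n : ℕ} (hn : ¬ p ∣ n) : (n : ℚ)⁻¹ ∈ pIntegers p := by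
  rw [mem_pIntegers, isPInt]
  rcases Nat.eq_zero_or_pos n with rfl | h
  · simp at hn
  · rwa [Rat.inv_natCast_den_of_pos h]

lemma inv_mem_of_not_div_mem {x : ℚ} (hx : ¬ x / p ∈ pIntegers p) : x⁻¹ ∈ pIntegers p := by
  have hnum : ¬ p ∣ x.num.natAbs := by
    intro h
    obtain ⟨m, hm⟩ := Int.natCast_dvd.2 h
    by_cases hd : p ∣ x.den
    · exact hp.out.one_lt.ne' (Nat.dvd_one.1 (x.reduced ▸ Nat.dvd_gcd h hd))
    · apply hx
      have : x / p = m * (x.den : ℚ)⁻¹ := by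
        conv_lhs => rw [← Rat.num_div_den x, hm]
        have := natCast_prime_ne_zero (p := p)
        push_cast
        field_simp
      rw [this]
      exact mul_mem (isPInt_int m) (inv_natCast_mem hd)
  have : x⁻¹ = x.den * (x.num.sign * (x.num.natAbs : ℚ)⁻¹) := by
    conv_lhs => rw [← Rat.num_div_den x, ← Int.sign_mul_natAbs x.num]
    rcases lt_trichotomy x.num 0 with h | h | h
    · simp [Int.sign_eq_neg_one_of_neg h, div_eq_mul_inv, inv_neg]
    · simp [h]
    · simp [Int.sign_eq_one_of_pos h, div_eq_mul_inv]
  rw [this]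
  exact mul_mem (isPInt_nat _) (mul_mem (isPInt_int _) (inv_natCast_mem hnum))

lemma ne_zero_of_not_div_mem {x : ℚ} (hx : ¬ x / p ∈ pIntegers p) : x ≠ 0 := by
  rintro rfl
  exact hx (by simp)

lemma not_div_mem_natCast_add {n : ℕ} (hn : ¬ p ∣ n) {c : ℚ} (hc : c ∈ pIntegers p) :
    ¬ ((n : ℚ) + p * c) / p ∈ pIntegers p := by
  intro h
  have hp0 := natCast_prime_ne_zero (p := p)
  have h2 : (p : ℚ)⁻¹ ∈ pIntegers p := by
    have hn0 : (n : ℚ) ≠ 0 := by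
      rintro h0
      exact hn (by simp [Nat.cast_eq_zero.1 h0])
    have : (p : ℚ)⁻¹ = (((n : ℚ) + p * c) / p - c) * (n : ℚ)⁻¹ := by field_simp; ring
    rw [this]
    exact mul_mem (sub_mem h hc) (inv_natCast_mem hn)
  rw [mem_pIntegers, isPInt, Rat.inv_natCast_den_of_pos hp.out.pos] at h2
  exact h2 dvd_rfl

lemma inv_natCast_add_mem {n : ℕ} (hn : ¬ p ∣ n) {c : ℚ} (hc : c ∈ pIntegers p) :
    ((n : ℚ) + p * c)⁻¹ ∈ pIntegers p :=
  inv_mem_of_not_div_mem (not_div_mem_natCast_add hn hc)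

lemma natCast_add_ne_zero {n : ℕ} (hn : ¬ p ∣ n) {c : ℚ} (hc : c ∈ pIntegers p) :
    (n : ℚ) + p * c ≠ 0 :=
  ne_zero_of_not_div_mem (not_div_mem_natCast_add hn hc)

lemma pCong_of_eq {k : ℕ} {x y : ℚ} (r : ℚ) (hr : r ∈ pIntegers p) (h : x - y = (p : ℚ) ^ k * r) :
    pCong p k x y := by
  have hp0 := natCast_prime_ne_zero (p := p)
  rw [pCong, h, mul_div_cancel_left₀ _ (pow_ne_zero _ hp0)]
  exact hr

lemma pCong.exists {k : ℕ} {x y : ℚ} (h : pCong p k x y) :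
    ∃ r ∈ pIntegers p, x = y + (p : ℚ) ^ k * r := by
  have hp0 := natCast_prime_ne_zero (p := p)
  exact ⟨_, h, by field_simp; ring⟩

lemma pCong.refl {k : ℕ} (x : ℚ) : pCong p k x x := pCong_of_eq 0 (zero_mem _) (by simp)

lemma pCong.symm {k : ℕ} {x y : ℚ} (h : pCong p k x y) : pCong p k y x := by
  obtain ⟨r, hr, rfl⟩ := h.exists
  exact pCong_of_eq (-r) (neg_mem hr) (by ring)

lemma pCong.trans {k : ℕ} {x y z : ℚ} (h : pCong p k x y) (h' : pCong p k y z) :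
    pCong p k x z := by
  obtain ⟨r, hr, rfl⟩ := h.exists
  obtain ⟨r', hr', rfl⟩ := h'.exists
  exact pCong_of_eq (r' + r) (add_mem hr' hr) (by ring)

lemma pCong.add {k : ℕ} {x y z w : ℚ} (h : pCong p k x y) (h' : pCong p k z w) :
    pCong p k (x + z) (y + w) := by
  obtain ⟨r, hr, rfl⟩ := h.exists
  obtain ⟨r', hr', rfl⟩ := h'.exists
  exact pCong_of_eq (r' + r) (add_mem hr' hr) (by ring)

lemma pCong.mul_left {k : ℕ} {x y c : ℚ} (hc : c ∈ pIntegers p) (h : pCong p k x y) :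
    pCong p k (c * x) (c * y) := by
  obtain ⟨r, hr, rfl⟩ := h.exists
  exact pCong_of_eq (c * r) (mul_mem hc hr) (by ring)

lemma pCong.sum {ι : Type*} {k : ℕ} {s : Finset ι} {f g : ι → ℚ}
    (h : ∀ i ∈ s, pCong p k (f i) (g i)) : pCong p k (∑ i ∈ s, f i) (∑ i ∈ s, g i) := by
  classical
  induction s using Finset.induction_on with
  | empty => simpa using pCong.refl 0
  | insert a s ha ih =>
    rw [Finset.sum_insert ha, Finset.sum_insert ha]
    exact (h a (by simp)).add (ih fun i hi => h i (by simp [hi]))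

lemma pCong.mul_prime {k : ℕ} {x y : ℚ} (h : pCong p k x y) :
    pCong p (k + 1) (p * x) (p * y) := by
  obtain ⟨r, hr, rfl⟩ := h.exists
  exact pCong_of_eq r hr (by ring)

lemma pCong.mul_one_add {X Y N D u v : ℚ} (hX : pCong p 2 X (N * (1 + p * u)))
    (hY : pCong p 2 Y (D * (1 + p * v))) (hN : N ∈ pIntegers p) (hD : D ∈ pIntegers p)
    (hu : u ∈ pIntegers p) (hv : v ∈ pIntegers p) :
    pCong p 2 (X * Y) (N * D * (1 + p * (u + v))) := by
  obtain ⟨r, hr, rfl⟩ := hX.exists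
  obtain ⟨r', hr', rfl⟩ := hY.exists
  have hp' : (p : ℚ) ∈ pIntegers p := isPInt_nat p
  have h1 := one_mem (pIntegers p)
  refine pCong_of_eq (N * D * (u * v) + N * (1 + p * u) * r' + r * (D * (1 + p * v))
    + p * (p * (r * r'))) ?_ (by ring)
  refine add_mem (add_mem (add_mem ?_ ?_) ?_) ?_
  · exact mul_mem (mul_mem hN hD) (mul_mem hu hv)
  · exact mul_mem (mul_mem hN (add_mem h1 (mul_mem hp' hu))) hr'
  · exact mul_mem hr (mul_mem hD (add_mem h1 (mul_mem hp' hv)))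
  · exact mul_mem hp' (mul_mem hp' (mul_mem hr hr'))

lemma pCong_prod_add {n : ℕ} {u : ℕ → ℚ} {c : ℚ} (hc : c ∈ pIntegers p)
    (hu : ∀ j < n, u j ∈ pIntegers p) (hu0 : ∀ j < n, u j ≠ 0)
    (hu' : ∀ j < n, (u j)⁻¹ ∈ pIntegers p) :
    pCong p 2 (∏ j ∈ Finset.range n, (u j + p * c))
      ((∏ j ∈ Finset.range n, u j) * (1 + p * (c * ∑ j ∈ Finset.range n, (u j)⁻¹))) := by
  induction n with
  | zero => simpa using pCong.refl 1
  | succ n ih =>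
    rw [Finset.prod_range_succ, Finset.prod_range_succ, Finset.sum_range_succ, mul_add c]
    refine (ih (fun j hj => hu j (by omega)) (fun j hj => hu0 j (by omega))
      (fun j hj => hu' j (by omega))).mul_one_add ?_ ?_ (hu n (by omega)) ?_ ?_
    · have : u n + p * c = u n * (1 + p * (c * (u n)⁻¹)) := by
        have := hu0 n (by omega)
        field_simp
      rw [this]
      exact pCong.refl _
    · exact prod_mem fun j hj => hu j (by have := Finset.mem_range.1 hj; omega)
    · exact mul_mem hc (sum_mem fun j hj => hu' j (by have := Finset.mem_range.1 hj; omega))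
    · exact mul_mem hc (hu' n (by omega))

end PIntegers

lemma harmonic_add (m n : ℕ) :
    harmonic (m + n) = harmonic m + ∑ i ∈ Finset.range n, ((m + i + 1 : ℕ) : ℚ)⁻¹ := by
  rw [harmonic, Finset.sum_range_add, harmonic]

section Hypergeometric

/-- The summand `C(x, k) C(-1-x, k)`. -/
def rchooseMul (x : ℚ) (k : ℕ) : ℚ := rchoose x k * rchoose (-1 - x) k

lemma rchooseMul_zero (x : ℚ) : rchooseMul x 0 = 1 := by simp [rchooseMul, rchoose]

lemma rchooseMul_succ (x : ℚ) (k : ℕ) :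
    rchooseMul x (k + 1) = rchooseMul x k * ((x - k) * (-1 - x - k) / (k + 1) ^ 2) := by
  have h1 : (k.factorial : ℚ) ≠ 0 := by exact_mod_cast k.factorial_ne_zero
  have h2 : (k + 1 : ℚ) ≠ 0 := by positivity
  simp only [rchooseMul, rchoose, Finset.prod_range_succ, Nat.factorial_succ]
  push_cast
  field_simp

lemma mul_rchooseMul (x : ℚ) (k : ℕ) : x * rchooseMul x k =
    (x + k) * ∏ i ∈ Finset.range k, ((i : ℚ) ^ 2 - x ^ 2) / (i + 1) ^ 2 := by
  induction k with
  | zero => simp [rchooseMul_zero]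
  | succ k ih =>
    rw [rchooseMul_succ, ← mul_assoc, ih, Finset.prod_range_succ]
    push_cast
    ring

lemma mul_rchooseMul_sub_one (x : ℚ) (k : ℕ) : x * rchooseMul (x - 1) k =
    (x - k) * ∏ i ∈ Finset.range k, ((i : ℚ) ^ 2 - x ^ 2) / (i + 1) ^ 2 := by
  induction k with
  | zero => simp [rchooseMul_zero]
  | succ k ih =>
    rw [rchooseMul_succ, ← mul_assoc, ih, Finset.prod_range_succ]
    push_cast
    ring

lemma sum_prod_sq_sub_sq (x : ℚ) (n : ℕ) :
    ∑ k ∈ Finset.range (n + 1), ∏ i ∈ Finset.range k, ((i : ℚ) ^ 2 - x ^ 2) / (i + 1) ^ 2 =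
      ∏ i ∈ Finset.range n, (1 - x ^ 2 / (i + 1) ^ 2) := by
  have aux : ∀ k : ℕ, (-x ^ 2) * ∏ i ∈ Finset.range k, (1 - x ^ 2 / ((i : ℚ) + 1) ^ 2) =
      (k + 1) ^ 2 * ∏ i ∈ Finset.range (k + 1), ((i : ℚ) ^ 2 - x ^ 2) / (i + 1) ^ 2 := by
    intro k
    induction k with
    | zero => simp
    | succ k ih =>
      rw [Finset.prod_range_succ, ← mul_assoc, ih, Finset.prod_range_succ _ (k + 1)]
      have h2 : (k + 1 : ℚ) ≠ 0 := by positivity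
      have h3 : (k + 1 + 1 : ℚ) ≠ 0 := by positivity
      push_cast
      field_simp
  induction n with
  | zero => simp
  | succ n ih =>
    have h2 : (n + 1 : ℚ) ≠ 0 := by positivity
    rw [Finset.sum_range_succ, ih,
      eq_div_of_mul_eq (pow_ne_zero 2 h2) ((mul_comm _ _).trans (aux n).symm),
      Finset.prod_range_succ]
    ring

lemma sum_rchooseMul_div_rec {x b : ℚ} (hx : x ≠ 0) (n : ℕ) (hb : ∀ k < n + 1, (k : ℚ) + b ≠ 0) :
    (x + b) * ∑ k ∈ Finset.range (n + 1), rchooseMul x k / (k + b) =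
      (x - b) * ∑ k ∈ Finset.range (n + 1), rchooseMul (x - 1) k / (k + b) +
        2 * ∏ i ∈ Finset.range n, (1 - x ^ 2 / ((i : ℚ) + 1) ^ 2) := by
  rw [← sum_prod_sq_sub_sq, Finset.mul_sum, Finset.mul_sum, Finset.mul_sum,
    ← Finset.sum_add_distrib]
  refine Finset.sum_congr rfl fun k hk => ?_
  have hkb := hb k (Finset.mem_range.1 hk)
  rw [eq_div_of_mul_eq hx ((mul_comm _ x).trans (mul_rchooseMul x k)),
    eq_div_of_mul_eq hx ((mul_comm _ x).trans (mul_rchooseMul_sub_one x k))]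
  generalize ∏ i ∈ Finset.range k, ((i : ℚ) ^ 2 - x ^ 2) / (i + 1) ^ 2 = Q
  field_simp
  ring

lemma rchooseMul_succ_eq (x : ℚ) (k : ℕ) : rchooseMul x (k + 1) =
    -(x * (x + (k + 1)) / (k + 1) ^ 2) *
      ∏ i ∈ Finset.range k, (1 - x ^ 2 / ((i : ℚ) + 1) ^ 2) := by
  induction k with
  | zero => simp [rchooseMul_succ, rchooseMul_zero]; ring
  | succ k ih =>
    rw [rchooseMul_succ, ih, Finset.prod_range_succ]
    have h2 : (k + 1 : ℚ) ≠ 0 := by positivity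
    have h3 : (k + 1 + 1 : ℚ) ≠ 0 := by positivity
    push_cast
    field_simp
    ring

end Hypergeometric

section Congruence

variable {p : ℕ} [hp : Fact p.Prime]

lemma natCast_mem_pIntegers (n : ℕ) : (n : ℚ) ∈ pIntegers p := isPInt_nat n

lemma inv_natCast_mem_of_lt {n : ℕ} (h0 : 0 < n) (hn : n < p) : (n : ℚ)⁻¹ ∈ pIntegers p :=
  inv_natCast_mem (Nat.not_dvd_of_pos_of_lt h0 hn)

lemma pCong_prod_one_sub_sq {t : ℚ} (ht : t ∈ pIntegers p) {k : ℕ} (hk : k < p) :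
    pCong p 2 (∏ i ∈ Finset.range k, (1 - (p * t) ^ 2 / ((i : ℚ) + 1) ^ 2)) 1 := by
  induction k with
  | zero => simpa using pCong.refl 1
  | succ k ih =>
    obtain ⟨r, hr, h⟩ := (ih (by omega)).exists
    rw [Finset.prod_range_succ, h]
    have hk' : ((k : ℚ) + 1)⁻¹ ∈ pIntegers p := by
      exact_mod_cast inv_natCast_mem_of_lt (Nat.succ_pos k) hk
    have hpR := natCast_mem_pIntegers (p := p) p
    refine pCong_of_eq (r - (1 + p ^ 2 * r) * (t ^ 2 * ((k + 1 : ℚ)⁻¹) ^ 2)) ?_ ?_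
    · exact sub_mem hr (mul_mem (add_mem (one_mem _) (mul_mem (pow_mem hpR _) hr))
        (mul_mem (pow_mem ht _) (pow_mem hk' _)))
    · have : (k + 1 : ℚ) ≠ 0 := by positivity
      field_simp
      ring

lemma pCong_prod_one_sub_sq_zero (hodd : Odd p) {t : ℚ} (ht : t ∈ pIntegers p) {j : ℕ}
    (h0 : 0 < j) (hj : j < p) :
    pCong p 2 (∏ i ∈ Finset.range (p - 1), (1 - (p * t + j) ^ 2 / ((i : ℚ) + 1) ^ 2)) 0 := by
  have hinv : ∀ i < p - 1, ((i : ℚ) + 1)⁻¹ ∈ pIntegers p := fun i hi => by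
    exact_mod_cast inv_natCast_mem_of_lt (Nat.succ_pos i) (by omega)
  have hpR := natCast_mem_pIntegers (p := p) p
  have hjR := natCast_mem_pIntegers (p := p) j
  have hmem : ∀ i ∈ Finset.range (p - 1),
      1 - (p * t + j) ^ 2 / ((i : ℚ) + 1) ^ 2 ∈ pIntegers p := fun i hi => by
    rw [div_eq_mul_inv, ← inv_pow]
    exact sub_mem (one_mem _) (mul_mem (pow_mem (add_mem (mul_mem hpR ht) hjR) _)
      (pow_mem (hinv i (Finset.mem_range.1 hi)) _))
  have hdvd : ∀ i < p - 1, (i + 1 = j ∨ i + 1 + j = p) → ∃ r ∈ pIntegers p,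
      1 - (p * t + j) ^ 2 / ((i : ℚ) + 1) ^ 2 = p * r := by
    rintro i hi h
    have hi' := hinv i hi
    have hi0 : (i + 1 : ℚ) ≠ 0 := by positivity
    have hiR : (i : ℚ) + 1 ∈ pIntegers p := add_mem (natCast_mem_pIntegers i) (one_mem _)
    rcases h with h | h
    · refine ⟨-(t * (p * t + j + (i + 1)) * ((i + 1 : ℚ)⁻¹) ^ 2), neg_mem (mul_mem
        (mul_mem ht (add_mem (add_mem (mul_mem hpR ht) hjR) hiR)) (pow_mem hi' _)), ?_⟩
      have : (j : ℚ) = i + 1 := by exact_mod_cast h.symm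
      rw [this]
      field_simp
      ring
    · refine ⟨(t + 1) * ((i + 1) - (p * t + j)) * ((i + 1 : ℚ)⁻¹) ^ 2, mul_mem
        (mul_mem (add_mem ht (one_mem _)) (sub_mem hiR (add_mem (mul_mem hpR ht) hjR)))
        (pow_mem hi' _), ?_⟩
      have : (j : ℚ) = p - (i + 1) := by
        rw [eq_sub_iff_add_eq, add_comm]; exact_mod_cast h
      rw [this]
      field_simp
      ring
  have h1 : j - 1 ∈ Finset.range (p - 1) := Finset.mem_range.2 (by omega)
  have h2 : p - 1 - j ∈ (Finset.range (p - 1)).erase (j - 1) := by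
    obtain ⟨m, hm⟩ := hodd
    exact Finset.mem_erase.2 ⟨by omega, Finset.mem_range.2 (by omega)⟩
  obtain ⟨r₁, hr₁, e₁⟩ := hdvd (j - 1) (by omega) (by omega)
  obtain ⟨r₂, hr₂, e₂⟩ := hdvd (p - 1 - j) (by omega) (by omega)
  rw [← Finset.mul_prod_erase _ _ h1, ← Finset.mul_prod_erase _ _ h2, e₁, e₂]
  refine pCong_of_eq _ (mul_mem (mul_mem hr₁ hr₂) (prod_mem fun i hi =>
    hmem i (Finset.mem_of_mem_erase (Finset.mem_of_mem_erase hi)))) (by ring)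

variable {s t : ℚ} {B : ℕ}

lemma natCast_add_shift_ne_zero (hs : s ∈ pIntegers p) (hs1 : ¬ (s + 1) / p ∈ pIntegers p)
    (hB0 : 0 < B) (hB : B < p) {k : ℕ} (hk : k < p) : (k : ℚ) + (B + p * s) ≠ 0 := by
  have hp0 := natCast_prime_ne_zero (p := p)
  by_cases hd : p ∣ k + B
  · obtain ⟨m, hm⟩ := hd
    have : m = 1 := by
      have h1 : m < 2 := by
        by_contra! h
        have := Nat.mul_le_mul_left p h
        omega
      have h2 : m ≠ 0 := by rintro rfl; omega
      omega
    subst this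
    have e : (k : ℚ) + (B + p * s) = p * (s + 1) := by
      have : (k : ℚ) + B = p * 1 := by exact_mod_cast hm
      linear_combination this
    rw [e]
    exact mul_ne_zero hp0 (ne_zero_of_not_div_mem hs1)
  · have := natCast_add_ne_zero hd hs
    push_cast at this
    rwa [add_assoc] at this

lemma pCong_sum_step (hodd : Odd p) (ht : t ∈ pIntegers p) (hs : s ∈ pIntegers p)
    (hs1 : ¬ (s + 1) / p ∈ pIntegers p) {j : ℕ} (hj : 0 < j) (hB0 : 0 < B) (hjB : j + B < p) :
    pCong p 2 (∑ k ∈ Finset.range p, rchooseMul (p * t + j) k / (k + (B + p * s)))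
      ((p * t + j - (B + p * s)) / (p * t + j + (B + p * s)) *
        ∑ k ∈ Finset.range p, rchooseMul (p * t + j - 1) k / (k + (B + p * s))) := by
  have hjp : ¬ p ∣ j := Nat.not_dvd_of_pos_of_lt hj (by omega)
  have hjBp : ¬ p ∣ j + B := Nat.not_dvd_of_pos_of_lt (by omega) hjB
  have e : p * t + j + (B + p * s) = ((j + B : ℕ) : ℚ) + p * (t + s) := by push_cast; ring
  have hx0 : p * t + j ≠ 0 := by
    rw [add_comm]; exact natCast_add_ne_zero hjp ht
  have hxb : p * t + j + (B + p * s) ≠ 0 := by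
    rw [e]; exact natCast_add_ne_zero hjBp (add_mem ht hs)
  have hxb' : (p * t + j + (B + p * s))⁻¹ ∈ pIntegers p := by
    rw [e]; exact inv_natCast_add_mem hjBp (add_mem ht hs)
  obtain ⟨r, hr, h⟩ := (pCong_prod_one_sub_sq_zero hodd ht hj (by omega)).exists
  have hrec := sum_rchooseMul_div_rec hx0 (b := B + p * s) (p - 1) fun k hk =>
    natCast_add_shift_ne_zero hs hs1 hB0 (by omega) (by omega)
  rw [Nat.sub_add_cancel hp.out.one_le, h] at hrec
  refine pCong_of_eq (2 * r * (p * t + j + (B + p * s))⁻¹)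
    (mul_mem (mul_mem (by exact_mod_cast natCast_mem_pIntegers (p := p) 2) hr) hxb') ?_
  generalize (∑ k ∈ Finset.range p, rchooseMul (p * t + j) k / (k + (B + p * s))) = S at *
  generalize (∑ k ∈ Finset.range p, rchooseMul (p * t + j - 1) k / (k + (B + p * s))) = S' at *
  field_simp
  linear_combination hrec

lemma pCong_sum_iterate (hodd : Odd p) (ht : t ∈ pIntegers p) (hs : s ∈ pIntegers p)
    (hs1 : ¬ (s + 1) / p ∈ pIntegers p) (hB0 : 0 < B) {n : ℕ} (hn : n + B < p) :
    pCong p 2 (∑ k ∈ Finset.range p, rchooseMul (p * t + n) k / (k + (B + p * s)))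
      ((∏ j ∈ Finset.range n,
          (p * t + (j + 1 : ℕ) - (B + p * s)) / (p * t + (j + 1 : ℕ) + (B + p * s))) *
        ∑ k ∈ Finset.range p, rchooseMul (p * t) k / (k + (B + p * s))) := by
  induction n with
  | zero => simpa using pCong.refl _
  | succ n ih =>
    refine (pCong_sum_step hodd ht hs hs1 (Nat.succ_pos n) hB0 hn).trans ?_
    rw [Finset.prod_range_succ, mul_comm (∏ j ∈ _, _), mul_assoc]
    have hpR := natCast_mem_pIntegers (p := p) p
    refine pCong.mul_left ?_ ?_
    · have e : p * t + (n + 1 : ℕ) + (B + p * s) =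
          ((n + 1 + B : ℕ) : ℚ) + p * (t + s) := by push_cast; ring
      rw [e, div_eq_mul_inv]
      exact mul_mem (sub_mem (add_mem (mul_mem hpR ht) (natCast_mem_pIntegers _))
        (add_mem (natCast_mem_pIntegers _) (mul_mem hpR hs)))
        (inv_natCast_add_mem (Nat.not_dvd_of_pos_of_lt (by omega) hn) (add_mem ht hs))
    · have e : (p * t + (n + 1 : ℕ) - 1 : ℚ) = p * t + n := by push_cast; ring
      rw [e]
      exact ih (by omega)

lemma pCong_term (ht : t ∈ pIntegers p) (hs : s ∈ pIntegers p) (hB0 : 0 < B) (hB : B < p)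
    {k : ℕ} (hk : k + 1 < p) (hkB : ¬ p ∣ k + 1 + B) :
    pCong p 2 (rchooseMul (p * t) (k + 1) / ((k + 1 : ℕ) + (B + p * s)))
      (p * (-(t * (B + p * s : ℚ)⁻¹) *
        (((k + 1 : ℕ) : ℚ)⁻¹ - ((k + 1 + B : ℕ) : ℚ)⁻¹))) := by
  have hpR := natCast_mem_pIntegers (p := p) p
  have hBp : ¬ p ∣ B := Nat.not_dvd_of_pos_of_lt hB0 hB
  have hb := inv_natCast_add_mem hBp hs
  have hb0 := natCast_add_ne_zero hBp hs
  have hkb := inv_natCast_add_mem hkB hs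
  have hkb0 := natCast_add_ne_zero hkB hs
  have hkB' := inv_natCast_mem hkB
  have hk' := inv_natCast_mem_of_lt (Nat.succ_pos k) hk
  have hk0 : (k + 1 : ℚ) ≠ 0 := by positivity
  have hkB0 : (k + 1 + B : ℚ) ≠ 0 := by positivity
  obtain ⟨r, hr, h⟩ := (pCong_prod_one_sub_sq ht (k := k) (by omega)).exists
  rw [rchooseMul_succ_eq, h]
  push_cast at *
  rw [← add_assoc ((k : ℚ) + 1) B (p * s)]
  refine pCong_of_eq (-(t ^ 2 * ((k + 1 : ℚ)⁻¹) ^ 2 * (k + 1 + B + p * s : ℚ)⁻¹)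
    - p * t * (p * t + (k + 1)) * ((k + 1 : ℚ)⁻¹) ^ 2 * (k + 1 + B + p * s : ℚ)⁻¹ * r
    - t * (B + p * s : ℚ)⁻¹ * s * (k + 1 + B + p * s : ℚ)⁻¹ * (k + 1 + B : ℚ)⁻¹) ?_ ?_
  · have hkR : (k : ℚ) + 1 ∈ pIntegers p := add_mem (natCast_mem_pIntegers k) (one_mem _)
    refine sub_mem (sub_mem (neg_mem (mul_mem (mul_mem (pow_mem ht _) (pow_mem hk' _)) hkb)) ?_) ?_
    · exact mul_mem (mul_mem (mul_mem (mul_mem (mul_mem hpR ht)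
        (add_mem (mul_mem hpR ht) hkR)) (pow_mem hk' _)) hkb) hr
    · exact mul_mem (mul_mem (mul_mem (mul_mem ht hb) hs) hkb) hkB'
  · field_simp
    ring

lemma pCong_sum_inv_sub_inv {m n : ℕ} (h : m + 1 + (n + 1) = p) (hs : s ∈ pIntegers p) :
    pCong p 1
      (∑ i ∈ Finset.range m, (((i + 1 : ℕ) : ℚ)⁻¹ - ((i + 1 + (n + 1) : ℕ) : ℚ)⁻¹) +
        ∑ i ∈ Finset.range n,
          (((m + 1 + i + 1 : ℕ) : ℚ)⁻¹ - ((m + 1 + i + 1 + (n + 1) : ℕ) : ℚ)⁻¹))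
      (2 * (((n + 1 : ℕ) : ℚ) + p * s)⁻¹) := by
  have hnp : ¬ p ∣ n + 1 := Nat.not_dvd_of_pos_of_lt (by omega) (by omega)
  have hn := inv_natCast_mem hnp
  have hm : ((m + 1 : ℕ) : ℚ)⁻¹ ∈ pIntegers p := inv_natCast_mem_of_lt (by omega) (by omega)
  have hb := inv_natCast_add_mem hnp hs
  have hb0 := natCast_add_ne_zero hnp hs
  have hshift : pCong p 1 (∑ i ∈ Finset.range n, ((m + 1 + i + 1 + (n + 1) : ℕ) : ℚ)⁻¹)
      (harmonic n) := by
    rw [harmonic]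
    refine pCong.sum fun i hi => ?_
    have hi := Finset.mem_range.1 hi
    have h1 : ((i + 1 : ℕ) : ℚ)⁻¹ ∈ pIntegers p := inv_natCast_mem_of_lt (by omega) (by omega)
    have h2 : ((p + (i + 1) : ℕ) : ℚ)⁻¹ ∈ pIntegers p := inv_natCast_mem fun hd =>
      Nat.not_dvd_of_pos_of_lt (Nat.succ_pos i) (by omega) ((Nat.dvd_add_right dvd_rfl).1 hd)
    rw [show m + 1 + i + 1 + (n + 1) = p + (i + 1) by omega]
    refine pCong_of_eq (-(((p + (i + 1) : ℕ) : ℚ)⁻¹ * ((i + 1 : ℕ) : ℚ)⁻¹))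
      (neg_mem (mul_mem h2 h1)) ?_
    have e1 : ((i + 1 : ℕ) : ℚ) ≠ 0 := Nat.cast_ne_zero.2 (by omega)
    have e2 : ((p + (i + 1) : ℕ) : ℚ) ≠ 0 := Nat.cast_ne_zero.2 (by omega)
    field_simp
    push_cast
    ring
  obtain ⟨r, hr, e⟩ := hshift.exists
  have e₁ := harmonic_add (m + 1) n
  have e₂ := harmonic_add (n + 1) m
  rw [show n + 1 + m = m + 1 + n by omega, e₁, harmonic_succ, harmonic_succ] at e₂
  have e₃ : ∑ i ∈ Finset.range m, ((i + 1 + (n + 1) : ℕ) : ℚ)⁻¹ =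
      ∑ i ∈ Finset.range m, ((n + 1 + i + 1 : ℕ) : ℚ)⁻¹ :=
    Finset.sum_congr rfl fun i _ => by congr 2; omega
  have e₄ : ∑ i ∈ Finset.range m, ((i + 1 : ℕ) : ℚ)⁻¹ = harmonic m := rfl
  rw [Finset.sum_sub_distrib, Finset.sum_sub_distrib, e, e₃, e₄]
  refine pCong_of_eq (-r - ((m + 1 : ℕ) : ℚ)⁻¹ * ((n + 1 : ℕ) : ℚ)⁻¹
    + 2 * (s * ((n + 1 : ℕ) : ℚ)⁻¹ * (((n + 1 : ℕ) : ℚ) + p * s)⁻¹)) ?_ ?_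
  · exact add_mem (sub_mem (neg_mem hr) (mul_mem hm hn))
      (mul_mem (by exact_mod_cast natCast_mem_pIntegers (p := p) 2) (mul_mem (mul_mem hs hn) hb))
  · have hpe : (p : ℚ) = (m + 1 : ℕ) + (n + 1 : ℕ) := by rw [← h]; push_cast; ring
    have f1 : p * (((m + 1 : ℕ) : ℚ)⁻¹ * ((n + 1 : ℕ) : ℚ)⁻¹) =
        ((m + 1 : ℕ) : ℚ)⁻¹ + ((n + 1 : ℕ) : ℚ)⁻¹ := by
      rw [hpe]
      have e1 : ((m + 1 : ℕ) : ℚ) ≠ 0 := Nat.cast_ne_zero.2 (by omega)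
      have e2 : ((n + 1 : ℕ) : ℚ) ≠ 0 := Nat.cast_ne_zero.2 (by omega)
      field_simp
      ring
    have f2 : p * (s * ((n + 1 : ℕ) : ℚ)⁻¹ * (((n + 1 : ℕ) : ℚ) + p * s)⁻¹) =
        ((n + 1 : ℕ) : ℚ)⁻¹ - (((n + 1 : ℕ) : ℚ) + p * s)⁻¹ := by
      have e2 : ((n + 1 : ℕ) : ℚ) ≠ 0 := Nat.cast_ne_zero.2 (by omega)
      field_simp
      ring
    linear_combination e₂ + f1 - 2 * f2

lemma pCong_sum_base (ht : t ∈ pIntegers p) (hs : s ∈ pIntegers p)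
    (hs1 : ¬ (s + 1) / p ∈ pIntegers p) (hB0 : 0 < B) (hB : B < p) :
    pCong p 2 (∑ k ∈ Finset.range p, rchooseMul (p * t) k / (k + (B + p * s)))
      ((s + 1 + t) / ((B + p * s) * (s + 1)) * (1 + p * (-(t / (B + p * s))))) := by
  have hp0 := natCast_prime_ne_zero (p := p)
  have hpR := natCast_mem_pIntegers (p := p) p
  obtain ⟨n, rfl⟩ : ∃ n, B = n + 1 := ⟨B - 1, by omega⟩
  obtain ⟨m, hm⟩ : ∃ m, m + 1 + (n + 1) = p := ⟨p - 1 - (n + 1), by omega⟩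
  have hnp : ¬ p ∣ n + 1 := Nat.not_dvd_of_pos_of_lt (by omega) (by omega)
  have hb := inv_natCast_add_mem hnp hs
  have hb0 := natCast_add_ne_zero hnp hs
  have hs1' := inv_mem_of_not_div_mem hs1
  have hs10 := ne_zero_of_not_div_mem hs1
  have hmR : ((m + 1 : ℕ) : ℚ)⁻¹ ∈ pIntegers p := inv_natCast_mem_of_lt (by omega) (by omega)
  have hm0 : ((m + 1 : ℕ) : ℚ) ≠ 0 := Nat.cast_ne_zero.2 (by omega)
  have hpe : ((m + 1 : ℕ) : ℚ) + (n + 1 : ℕ) = p := by rw [← hm]; push_cast; ring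
  have hsplit : ∑ k ∈ Finset.range p, rchooseMul (p * t) k / (k + ((n + 1 : ℕ) + p * s)) =
      (((n + 1 : ℕ) + p * s : ℚ)⁻¹ +
        rchooseMul (p * t) (m + 1) / ((m + 1 : ℕ) + ((n + 1 : ℕ) + p * s))) +
      (∑ k ∈ Finset.range m, rchooseMul (p * t) (k + 1) /
          ((k + 1 : ℕ) + ((n + 1 : ℕ) + p * s)) +
        ∑ k ∈ Finset.range n, rchooseMul (p * t) (m + 1 + k + 1) /
          ((m + 1 + k + 1 : ℕ) + ((n + 1 : ℕ) + p * s))) := by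
    generalize (((n + 1 : ℕ) : ℚ) + p * s) = b
    rw [← hm, Finset.sum_range_add, Finset.sum_range_succ', Finset.sum_range_succ' _ n,
      rchooseMul_zero]
    simp only [Nat.add_zero, Nat.cast_zero, zero_add, one_div, Nat.add_assoc]
    ring
  have hrest := ((pCong.sum (s := Finset.range m) fun k hk => pCong_term (k := k) ht hs hB0 hB
      (by have := Finset.mem_range.1 hk; omega)
      (by have := Finset.mem_range.1 hk
          exact Nat.not_dvd_of_pos_of_lt (by omega) (by omega))).add
    (pCong.sum (s := Finset.range n) fun k hk => pCong_term (k := m + 1 + k) ht hs hB0 hB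
      (by have := Finset.mem_range.1 hk; omega)
      (by have := Finset.mem_range.1 hk
          rw [show m + 1 + k + 1 + (n + 1) = p + (k + 1) by omega]
          exact fun hd => Nat.not_dvd_of_pos_of_lt (Nat.succ_pos k) (by omega)
            ((Nat.dvd_add_right dvd_rfl).1 hd))))
  rw [← Finset.mul_sum, ← Finset.mul_sum, ← Finset.mul_sum, ← Finset.mul_sum, ← mul_add,
    ← mul_add] at hrest
  have hrest' := hrest.trans ((pCong_sum_inv_sub_inv hm hs).mul_left
    (c := -(t * ((n + 1 : ℕ) + p * s : ℚ)⁻¹)) (neg_mem (mul_mem ht hb))).mul_prime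
  have hmid : pCong p 2 (rchooseMul (p * t) (m + 1) / ((m + 1 : ℕ) + ((n + 1 : ℕ) + p * s)))
      (-(t * (p * t + (m + 1 : ℕ)) / (((m + 1 : ℕ) : ℚ) ^ 2 * (s + 1)))) := by
    obtain ⟨r, hr, h⟩ := (pCong_prod_one_sub_sq ht (k := m) (by omega)).exists
    rw [rchooseMul_succ_eq, h, ← add_assoc ((m + 1 : ℕ) : ℚ), hpe]
    refine pCong_of_eq (-(t * (p * t + (m + 1 : ℕ)) * (((m + 1 : ℕ) : ℚ)⁻¹) ^ 2
      * (s + 1)⁻¹ * r)) (neg_mem (mul_mem (mul_mem (mul_mem (mul_mem ht (add_mem (mul_mem hpR ht)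
      (natCast_mem_pIntegers _))) (pow_mem hmR _)) hs1') hr)) ?_
    push_cast at hm0 ⊢
    have : (p : ℚ) + p * s ≠ 0 := by
      have := mul_ne_zero hp0 hs10
      rwa [mul_add, mul_one, add_comm] at this
    rw [show (p : ℚ) + p * s = p * (s + 1) by ring]
    field_simp
    ring
  rw [hsplit]
  refine (((pCong.refl _).add hmid).add hrest').trans ?_
  have hM : ((m + 1 : ℕ) : ℚ) = p * (s + 1) - ((n + 1 : ℕ) + p * s) := by
    rw [← hpe]; ring
  have hbR : ((n + 1 : ℕ) + p * s : ℚ) ∈ pIntegers p :=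
    add_mem (natCast_mem_pIntegers _) (mul_mem hpR hs)
  have hs1R : s + 1 ∈ pIntegers p := add_mem hs (one_mem _)
  generalize (((n + 1 : ℕ) : ℚ) + p * s) = b at *
  generalize ((m + 1 : ℕ) : ℚ) = M at *
  refine pCong_of_eq (-(t * (s + 1) * b⁻¹ ^ 2 * M⁻¹)
    - t ^ 2 * b⁻¹ ^ 2 * M⁻¹ ^ 2 * (2 * b - p * (s + 1))) ?_ ?_
  · exact sub_mem (neg_mem (mul_mem (mul_mem (mul_mem ht hs1R) (pow_mem hb _)) hmR))
      (mul_mem (mul_mem (mul_mem (pow_mem ht _) (pow_mem hb _)) (pow_mem hmR _))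
      (sub_mem (mul_mem (by exact_mod_cast natCast_mem_pIntegers (p := p) 2) hbR)
        (mul_mem hpR hs1R)))
  · have hb' : b = p * (s + 1) - M := by linear_combination hM
    subst hb'
    field_simp
    ring

end Congruence

lemma choose_div_choose_eq_prod (m n k : ℕ) : (m.choose k : ℚ) / (n.choose k : ℚ) =
    (∏ j ∈ Finset.range k, ((m - j : ℕ) : ℚ)) / ∏ j ∈ Finset.range k, ((n - j : ℕ) : ℚ) := by
  have hk : (k.factorial : ℚ) ≠ 0 := by exact_mod_cast k.factorial_ne_zero
  rw [← Nat.cast_prod, ← Nat.cast_prod, ← Nat.descFactorial_eq_prod_range,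
    ← Nat.descFactorial_eq_prod_range, Nat.descFactorial_eq_factorial_mul_choose,
    Nat.descFactorial_eq_factorial_mul_choose, Nat.cast_mul, Nat.cast_mul,
    mul_div_mul_left _ _ hk]

section Ratio

variable {p : ℕ} [hp : Fact p.Prime] {s t : ℚ} {A B : ℕ}

lemma harmonic_mem {n : ℕ} (hn : n < p) : harmonic n ∈ pIntegers p :=
  sum_mem fun i hi => inv_natCast_mem_of_lt (Nat.succ_pos i)
    (by have := Finset.mem_range.1 hi; omega)

lemma sum_inv_sub_eq_harmonic_sub (hAB : A < B) :
    ∑ j ∈ Finset.range A, ((B - 1 - j : ℕ) : ℚ)⁻¹ = harmonic (B - 1) - harmonic (B - A - 1) := by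
  obtain ⟨c, rfl⟩ : ∃ c, B = c + A + 1 := ⟨B - A - 1, by omega⟩
  rw [show c + A + 1 - A - 1 = c by omega, show c + A + 1 - 1 = c + A by omega, harmonic_add,
    add_sub_cancel_left, ← Finset.sum_range_reflect]
  refine Finset.sum_congr rfl fun j hj => ?_
  have := Finset.mem_range.1 hj
  congr 2
  omega

lemma pCong_ratio (ht : t ∈ pIntegers p) (hs : s ∈ pIntegers p) (hAB : A < B)
    (hABp : A + B < p) :
    pCong p 2 ((∏ j ∈ Finset.range A,
        (p * t + (j + 1 : ℕ) - (B + p * s)) / (p * t + (j + 1 : ℕ) + (B + p * s))) *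
          (1 + p * (-(t / (B + p * s)))))
      (((B - 1).choose A : ℚ) / ((p - 1 - B).choose A : ℚ) *
        (1 + p * ((s + 1) / (B + p * s) + (2 * s + 1) * harmonic (B - 1)
          - (s - t) * harmonic (B - A - 1) - (s + t + 1) * harmonic (A + B)))) := by
  have hpR := natCast_mem_pIntegers (p := p) p
  have h2R : (2 : ℚ) ∈ pIntegers p := by exact_mod_cast natCast_mem_pIntegers (p := p) 2
  have h1R := one_mem (pIntegers p)
  have hBp : ¬ p ∣ B := Nat.not_dvd_of_pos_of_lt (by omega) (by omega)
  have hb := inv_natCast_add_mem hBp hs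
  have hb0 := natCast_add_ne_zero hBp hs
  have hB' := inv_natCast_mem hBp
  have hB0 : (B : ℚ) ≠ 0 := Nat.cast_ne_zero.2 (by omega)
  have hv : ∀ j < A, ¬ p ∣ B + j + 1 := fun j hj => Nat.not_dvd_of_pos_of_lt (by omega) (by omega)
  have hnum := pCong_prod_add (p := p) (n := A) (u := fun j => ((B - 1 - j : ℕ) : ℚ))
    (sub_mem hs ht) (fun j _ => natCast_mem_pIntegers _)
    (fun j hj => Nat.cast_ne_zero.2 (by omega))
    (fun j hj => inv_natCast_mem_of_lt (by omega) (by omega))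
  have hden := pCong_prod_add (p := p) (n := A) (u := fun j => ((B + j + 1 : ℕ) : ℚ))
    (add_mem ht hs) (fun j _ => natCast_mem_pIntegers _)
    (fun j hj => Nat.cast_ne_zero.2 (by omega)) (fun j hj => inv_natCast_mem (hv j hj))
  have hch := pCong_prod_add (p := p) (n := A) (u := fun j => ((B + j + 1 : ℕ) : ℚ))
    (neg_mem h1R) (fun j _ => natCast_mem_pIntegers _)
    (fun j hj => Nat.cast_ne_zero.2 (by omega)) (fun j hj => inv_natCast_mem (hv j hj))
  have hden0 : ∏ j ∈ Finset.range A, (((B + j + 1 : ℕ) : ℚ) + p * (t + s)) ≠ 0 :=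
    Finset.prod_ne_zero_iff.2 fun j hj =>
      natCast_add_ne_zero (hv j (Finset.mem_range.1 hj)) (add_mem ht hs)
  have hch0 : ∏ j ∈ Finset.range A, (((B + j + 1 : ℕ) : ℚ) + p * (-1)) ≠ 0 :=
    Finset.prod_ne_zero_iff.2 fun j hj =>
      natCast_add_ne_zero (hv j (Finset.mem_range.1 hj)) (neg_mem h1R)
  have hdenR : (∏ j ∈ Finset.range A, (((B + j + 1 : ℕ) : ℚ) + p * (t + s)))⁻¹
      ∈ pIntegers p := by
    rw [← Finset.prod_inv_distrib]
    exact prod_mem fun j hj =>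
      inv_natCast_add_mem (hv j (Finset.mem_range.1 hj)) (add_mem ht hs)
  have hchR : (∏ j ∈ Finset.range A, (((B + j + 1 : ℕ) : ℚ) + p * (-1)))⁻¹
      ∈ pIntegers p := by
    rw [← Finset.prod_inv_distrib]
    exact prod_mem fun j hj =>
      inv_natCast_add_mem (hv j (Finset.mem_range.1 hj)) (neg_mem h1R)
  have hNR : ∏ j ∈ Finset.range A, ((B - 1 - j : ℕ) : ℚ) ∈ pIntegers p :=
    prod_mem fun j _ => natCast_mem_pIntegers _
  have hDR : ∏ j ∈ Finset.range A, ((B + j + 1 : ℕ) : ℚ) ∈ pIntegers p :=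
    prod_mem fun j _ => natCast_mem_pIntegers _
  have e₁ : ∏ j ∈ Finset.range A,
      (p * t + (j + 1 : ℕ) - (B + p * s)) / (p * t + (j + 1 : ℕ) + (B + p * s)) =
      (-1) ^ A * (∏ j ∈ Finset.range A, (((B - 1 - j : ℕ) : ℚ) + p * (s - t))) /
        ∏ j ∈ Finset.range A, (((B + j + 1 : ℕ) : ℚ) + p * (t + s)) := by
    rw [Finset.prod_div_distrib]
    congr 1
    · conv_rhs => rw [← Finset.card_range A, ← Finset.prod_const, Finset.card_range,
        ← Finset.prod_mul_distrib]
      refine Finset.prod_congr rfl fun j hj => ?_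
      have := Finset.mem_range.1 hj
      rw [show B - 1 - j = B - (j + 1) by omega, Nat.cast_sub (by omega)]
      ring
    · refine Finset.prod_congr rfl fun j hj => ?_
      push_cast
      ring
  have e₂ : ∏ j ∈ Finset.range A, ((p - 1 - B - j : ℕ) : ℚ) =
      (-1) ^ A * ∏ j ∈ Finset.range A, (((B + j + 1 : ℕ) : ℚ) + p * (-1)) := by
    conv_rhs => rw [← Finset.card_range A, ← Finset.prod_const, Finset.card_range,
      ← Finset.prod_mul_distrib]
    refine Finset.prod_congr rfl fun j hj => ?_
    have := Finset.mem_range.1 hj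
    rw [show p - 1 - B - j = p - (B + j + 1) by omega, Nat.cast_sub (by omega)]
    ring
  have e₃ := harmonic_add B A
  rw [show B = B - 1 + 1 by omega, harmonic_succ, show B - 1 + 1 = B by omega,
    add_comm B A] at e₃
  rw [choose_div_choose_eq_prod, e₁, e₂]
  have hH₁ : harmonic (B - 1) ∈ pIntegers p := harmonic_mem (by omega)
  have hH₂ : harmonic (B - A - 1) ∈ pIntegers p := harmonic_mem (by omega)
  have hH₃ : harmonic (A + B) ∈ pIntegers p := harmonic_mem hABp
  have hσR : ∑ j ∈ Finset.range A, ((B + j + 1 : ℕ) : ℚ)⁻¹ ∈ pIntegers p :=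
    sum_mem fun j hj => inv_natCast_mem (hv j (Finset.mem_range.1 hj))
  rw [sum_inv_sub_eq_harmonic_sub hAB] at hnum
  have hbR : (B + p * s : ℚ) ∈ pIntegers p := add_mem (natCast_mem_pIntegers _) (mul_mem hpR hs)
  have hbe : (B : ℚ)⁻¹ - (B + p * s : ℚ)⁻¹ = p * (s * (B : ℚ)⁻¹ * (B + p * s : ℚ)⁻¹) := by
    field_simp
    ring
  simp only [div_eq_mul_inv t, div_eq_mul_inv (s + 1)]
  generalize ∏ j ∈ Finset.range A, (((B - 1 - j : ℕ) : ℚ) + p * (s - t)) = N' at *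
  generalize ∏ j ∈ Finset.range A, (((B + j + 1 : ℕ) : ℚ) + p * (t + s)) = D' at *
  generalize ∏ j ∈ Finset.range A, (((B + j + 1 : ℕ) : ℚ) + p * (-1)) = E' at *
  generalize ∏ j ∈ Finset.range A, ((B - 1 - j : ℕ) : ℚ) = N at *
  generalize ∏ j ∈ Finset.range A, ((B + j + 1 : ℕ) : ℚ) = D at *
  generalize ∑ j ∈ Finset.range A, ((B + j + 1 : ℕ) : ℚ)⁻¹ = σ at *
  generalize harmonic (B - 1) = H₁ at *
  generalize harmonic (B - A - 1) = H₂ at *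
  generalize harmonic (A + B) = H₃ at *
  generalize (B + p * s : ℚ)⁻¹ = b' at *
  set θ := (s + 1) * b' + (2 * s + 1) * H₁ - (s - t) * H₂ - (s + t + 1) * H₃ with hθ
  have hθR : θ ∈ pIntegers p := sub_mem (sub_mem (add_mem (mul_mem (add_mem hs h1R) hb)
    (mul_mem (add_mem (mul_mem h2R hs) h1R) hH₁)) (mul_mem (sub_mem hs ht) hH₂))
    (mul_mem (add_mem (add_mem hs ht) h1R) hH₃)
  have hl := (hnum.mul_one_add hch hNR hDR (mul_mem (sub_mem hs ht) (sub_mem hH₁ hH₂))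
    (mul_mem (neg_mem h1R) hσR)).mul_one_add (Y := 1 + p * (-(t * b'))) (D := 1)
    (v := -(t * b')) (by rw [one_mul]; exact pCong.refl _) (mul_mem hNR hDR) h1R
    (add_mem (mul_mem (sub_mem hs ht) (sub_mem hH₁ hH₂)) (mul_mem (neg_mem h1R) hσR))
    (neg_mem (mul_mem ht hb))
  have hr := hden.mul_one_add (pCong.refl (N * (1 + p * θ))) hDR hNR
    (mul_mem (add_mem ht hs) hσR) hθR
  have hlr : pCong p 2
      (N * D * 1 * (1 + p * ((s - t) * (H₁ - H₂) + -1 * σ + -(t * b'))))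
      (D * N * (1 + p * ((t + s) * σ + θ))) := by
    refine pCong_of_eq (N * D * ((s + t + 1) * (s * (B : ℚ)⁻¹ * b'))) (mul_mem (mul_mem hNR hDR)
      (mul_mem (add_mem (add_mem hs ht) h1R) (mul_mem (mul_mem hs hB') hb))) ?_
    rw [hθ]
    linear_combination N * D * p * (s + t + 1) * hbe + N * D * p * (s + t + 1) * e₃
  have hε : ((-1 : ℚ) ^ A) * (-1) ^ A = 1 := by rw [← mul_pow]; simp
  have hε0 : ((-1 : ℚ) ^ A) ≠ 0 := by positivity
  have hfin := ((hl.trans hlr).trans hr.symm).mul_left (c := (-1) ^ A * D'⁻¹ * E'⁻¹)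
    (mul_mem (mul_mem (pow_mem (neg_mem h1R) _) hdenR) hchR)
  generalize ((-1 : ℚ) ^ A) = ε at *
  convert hfin using 1
  · field_simp
  · field_simp
    linear_combination (-(N * (1 + p * θ))) * hε

end Ratio

theorem stmt1 (p : ℕ) (hp : p.Prime) (hodd : Odd p) (a b : ℚ) (A B : ℕ)
    (ha : isPInt p a) (hb : isPInt p b)
    (hA : A < p) (hB : B < p)
    (haA : pCong p 1 a (A : ℚ)) (hbB : pCong p 1 b (B : ℚ))
    (hab : ¬ pCong p 1 (a * b) 0)
    (hB1 : B ≤ p - 1 - A) (hB2 : A < B)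
    (hs : ¬ pCong p 1 ((b - B) / p) (-1)) :
    pCong p 2
      (∑ k ∈ Finset.range p, rchoose a k * rchoose (-1 - a) k / ((k : ℚ) + b))
      ((((b - B) / p) + 1 + ((a - A) / p)) / (b * (((b - B) / p) + 1)) *
        (((B - 1).choose A : ℚ) / ((p - 1 - B).choose A : ℚ)) *
        (1 + (p : ℚ) * (((b - B) / p) + 1) / b
          + (p : ℚ) * (2 * ((b - B) / p) + 1) * harmonic (B - 1)
          - (p : ℚ) * (((b - B) / p) - ((a - A) / p)) * harmonic (B - A - 1)
          - (p : ℚ) * (((b - B) / p) + ((a - A) / p) + 1) * harmonic (A + B))) := by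
  have : Fact p.Prime := ⟨hp⟩
  have hp0 := natCast_prime_ne_zero (p := p)
  have ht : (a - A) / p ∈ pIntegers p := by simpa [pCong, mem_pIntegers] using haA
  have hs' : (b - B) / p ∈ pIntegers p := by simpa [pCong, mem_pIntegers] using hbB
  have hs1 : ¬ ((b - B) / p + 1) / p ∈ pIntegers p := by simpa [pCong, mem_pIntegers] using hs
  have ea : a = p * ((a - A) / p) + A := by field_simp; ring
  have eb : b = B + p * ((b - B) / p) := by field_simp; ring
  have hB0 : 0 < B := by omega
  generalize (a - A) / p = t at *
  generalize (b - B) / p = s at *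
  subst ea eb
  have hpR := natCast_mem_pIntegers (p := p) p
  have hBp : ¬ p ∣ B := Nat.not_dvd_of_pos_of_lt hB0 hB
  have hC : (s + 1 + t) / ((B + p * s) * (s + 1)) ∈ pIntegers p := by
    rw [div_eq_mul_inv, mul_inv]
    exact mul_mem (add_mem (add_mem hs' (one_mem _)) ht)
      (mul_mem (inv_natCast_add_mem hBp hs') (inv_mem_of_not_div_mem hs1))
  have hprod : ∏ j ∈ Finset.range A,
      (p * t + (j + 1 : ℕ) - (B + p * s)) / (p * t + (j + 1 : ℕ) + (B + p * s))
        ∈ pIntegers p := by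
    refine prod_mem fun j hj => ?_
    have := Finset.mem_range.1 hj
    have e : p * t + (j + 1 : ℕ) + (B + p * s) =
        ((j + 1 + B : ℕ) : ℚ) + p * (t + s) := by push_cast; ring
    rw [e, div_eq_mul_inv]
    exact mul_mem (sub_mem (add_mem (mul_mem hpR ht) (natCast_mem_pIntegers _))
      (add_mem (natCast_mem_pIntegers _) (mul_mem hpR hs')))
      (inv_natCast_add_mem (Nat.not_dvd_of_pos_of_lt (by omega) (by omega)) (add_mem ht hs'))
  refine (pCong_sum_iterate hodd ht hs' hs1 hB0 (n := A) (by omega)).trans ?_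
  refine ((pCong_sum_base ht hs' hs1 hB0 hB).mul_left hprod).trans ?_
  have h := (pCong_ratio ht hs' hB2 (by omega)).mul_left hC
  convert h using 1 <;> ring
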